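/- Let b, d, k, n ≥ 1 be integers with C(n+d, n) ≥ 2·C(k+b, k), and let B ≥ 1 be real. There exists a constant c ≥ 1, depending only on b, d, k, n, B, with the following property. Suppose φ : (0,1)ᵏ → ℝⁿ is a map whose coordinate functions have continuous partial derivatives up to order b+1, all of modulus bounded by B on (0,1)ᵏ. Then for every real T ≥ 1 there exist an integer N ≥ 1 with N ≤ c·T^{(k+1)n·d/b} and nonzero polynomials f₁, …, f_N ∈ ℚ[X₁, …, Xₙ] with deg f_j ≤ d and |f_j| = 1 for all j, such that: whenever z ∈ (0,1)ᵏ and q ∈ ℚⁿ satisfy H(q) ≤ T and |φ(z) − q| < c⁻¹·T^{−((k+1)n/k)·(d(b+1)/b)}, there is some j ∈ {1, …, N} with f_j(q) = 0 and |f_j(φ(z))| ≤ c·|φ(z) − q|. -/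

import Mathlib

/-- The open unit hypercube `(0,1)ᵏ ⊂ ℝᵏ`. -/
def unitCube (k : ℕ) : Set (Fin k → ℝ) := Set.univ.pi fun _ => Set.Ioo (0 : ℝ) 1

/-- The iterated mixed partial derivative (within a set `S`) of `f : ℝᵏ → ℝ` along a
list of coordinate directions. -/
noncomputable def mixedPartialWithin {k : ℕ} (S : Set (Fin k → ℝ)) :
    List (Fin k) → ((Fin k → ℝ) → ℝ) → ((Fin k → ℝ) → ℝ)
  | [], f => f
  | j :: L, f => fun z => fderivWithin ℝ (mixedPartialWithin S L f) S z (Pi.single j 1)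

/-- The height of a rational number `a/b` in lowest terms (`b ≥ 1`) is `max |a| b`. -/
def ratHeight (q : ℚ) : ℕ := max q.num.natAbs q.den

/-- The height of a vector of rational numbers is the maximum of the heights of its
coordinates. -/
def vecHeight {n : ℕ} (q : Fin n → ℚ) : ℕ := Finset.univ.sup fun j => ratHeight (q j)

namespace AuxPoly

open Finset

noncomputable def degSet (n d : ℕ) : Finset (Fin n →₀ ℕ) :=
  (Finsupp.finite_of_degree_le (σ := Fin n) d).toFinset

lemma mem_degSet {n d : ℕ} {m : Fin n →₀ ℕ} : m ∈ degSet n d ↔ m.degree ≤ d := by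
  simp [degSet]

lemma degSet_succ (n d : ℕ) :
    degSet n (d+1) = degSet n d ∪ finsuppAntidiag (univ : Finset (Fin n)) (d+1) := by
  ext m
  simp only [mem_degSet, mem_union, mem_finsuppAntidiag, subset_univ, and_true,
    Finsupp.degree_eq_sum]
  have e : ∑ i, m i = univ.sum ⇑m := rfl
  omega

lemma card_degSet (n d : ℕ) : (degSet n d).card = (n + d).choose n := by
  have h : (degSet n d).card = Nat.multichoose (n+1) d := by
    induction d with
    | zero =>
      have : degSet n 0 = {0} := by
        ext m; simp [mem_degSet, Finsupp.degree_eq_zero_iff]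
      simp [this]
    | succ d ih =>
      rw [degSet_succ, card_union_of_disjoint, ih, card_finsuppAntidiag_nat_eq_multichoose,
        Nat.multichoose_succ_succ]
      · simp [add_comm]
      · rw [Finset.disjoint_left]
        intro m
        simp only [mem_degSet, mem_finsuppAntidiag, subset_univ, and_true,
          Finsupp.degree_eq_sum]
        have e : ∑ i, m i = univ.sum ⇑m := rfl
        omega
  rw [h, Nat.multichoose_eq]
  have : n + 1 + d - 1 = n + d := by omega
  rw [this, Nat.choose_symm_add]

lemma weight_degSet (k b : ℕ) :
    ∑ α ∈ degSet k b, (b + 1 - α.degree) = (k + b + 1).choose (k + 1) := by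
  induction b with
  | zero =>
      have : degSet k 0 = {0} := by
        ext m; simp [mem_degSet, Finsupp.degree_eq_zero_iff]
      simp [this]
  | succ b ih =>
    have h1 : ∑ α ∈ degSet k (b+1), (b + 1 + 1 - α.degree)
        = ∑ α ∈ degSet k (b+1), (1 + (b + 1 - α.degree)) := by
      apply sum_congr rfl
      intro α hα
      rw [mem_degSet] at hα
      omega
    have h2 : ∑ α ∈ degSet k (b+1), (b + 1 - α.degree)
        = ∑ α ∈ degSet k b, (b + 1 - α.degree) := by
      symm
      apply sum_subset
      · intro α; simp only [mem_degSet]; omega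
      · intro α; simp only [mem_degSet]; omega
    rw [h1, sum_add_distrib, h2, ih, sum_const, card_degSet, smul_eq_mul, mul_one]
    rw [show k + (b+1) + 1 = (k + b + 1) + 1 by ring, Nat.choose_succ_succ]
    rfl

/-- the weight identity and inequality -/
lemma weight_mul (k b : ℕ) :
    (k + 1) * (k + b + 1).choose (k + 1) = (k + b + 1) * (k + b).choose k := by
  have := Nat.add_one_mul_choose_eq (k+b) k
  rw [this]; ring

/-- evaluation of a monomial -/
noncomputable def mono {n : ℕ} (x : Fin n → ℝ) (m : Fin n →₀ ℕ) : ℝ := ∏ t, x t ^ m t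

lemma mono_zero {n : ℕ} (x : Fin n → ℝ) : mono x 0 = 1 := by simp [mono]

lemma mono_add {n : ℕ} (x : Fin n → ℝ) (m m' : Fin n →₀ ℕ) :
    mono x (m + m') = mono x m * mono x m' := by
  simp [mono, pow_add, prod_mul_distrib]

lemma mono_single {n : ℕ} (x : Fin n → ℝ) (t : Fin n) : mono x (Finsupp.single t 1) = x t := by
  classical
  unfold mono
  rw [Finset.prod_eq_single t]
  · simp
  · intro s _ hs
    rw [Finsupp.single_apply, if_neg (Ne.symm hs), pow_zero]
  · simp

lemma abs_mono_le {n : ℕ} (x : Fin n → ℝ) (m : Fin n →₀ ℕ) (r : ℝ) (hx : ‖x‖ ≤ r) :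
    |mono x m| ≤ r ^ m.degree := by
  unfold mono
  rw [Finset.abs_prod, Finsupp.degree_eq_sum, ← Finset.prod_pow_eq_pow_sum]
  apply Finset.prod_le_prod
  · intros; positivity
  · intro t _
    rw [abs_pow]
    gcongr
    exact (norm_le_pi_norm x t).trans hx

lemma finsupp_ind {n : ℕ} {Q : (Fin n →₀ ℕ) → Prop} (h0 : Q 0)
    (h1 : ∀ m t, Q m → Q (m + Finsupp.single t 1)) (m : Fin n →₀ ℕ) : Q m := by
  induction hN : m.degree generalizing m with
  | zero =>
    rw [Finsupp.degree_eq_zero_iff] at hN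
    rw [hN]; exact h0
  | succ N ih =>
    obtain ⟨t, ht⟩ : ∃ t, m t ≠ 0 := by
      by_contra hcon
      push Not at hcon
      have : m = 0 := by ext t; exact hcon t
      rw [this] at hN
      simp at hN
    have hle : Finsupp.single t 1 ≤ m := by
      rw [Finsupp.single_le_iff]; omega
    have e : m - Finsupp.single t 1 + Finsupp.single t 1 = m := tsub_add_cancel_of_le hle
    rw [← e]
    apply h1
    apply ih
    have := congrArg Finsupp.degree e
    rw [map_add, Finsupp.degree_single, hN] at this
    omega

/-- `p` is a finite sum of monomials with the ℓ¹ norm of coefficients at most `C`. -/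
def PolyRep {k : ℕ} (p : (Fin k → ℝ) → ℝ) (C : ℝ) : Prop :=
  ∃ (ι : Type) (_ : Fintype ι) (α : ι → Fin k →₀ ℕ) (a : ι → ℝ),
    ∑ i, |a i| ≤ C ∧ ∀ v, p v = ∑ i, a i * mono v (α i)

lemma PolyRep.mono' {k : ℕ} {p : (Fin k → ℝ) → ℝ} {C C' : ℝ} (h : PolyRep p C) (hC : C ≤ C') :
    PolyRep p C' := by
  obtain ⟨ι, _, α, a, h1, h2⟩ := h
  exact ⟨ι, _, α, a, h1.trans hC, h2⟩

lemma PolyRep.const {k : ℕ} (c : ℝ) : PolyRep (fun _ : Fin k → ℝ => c) |c| :=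
  ⟨Unit, inferInstance, fun _ => 0, fun _ => c, by simp, by simp [mono_zero]⟩

lemma PolyRep.coord {k : ℕ} (t : Fin k) : PolyRep (fun v : Fin k → ℝ => v t) 1 :=
  ⟨Unit, inferInstance, fun _ => Finsupp.single t 1, fun _ => 1, by simp, by simp [mono_single]⟩

lemma PolyRep.add {k : ℕ} {p q : (Fin k → ℝ) → ℝ} {C C' : ℝ} (h : PolyRep p C) (h' : PolyRep q C') :
    PolyRep (fun v => p v + q v) (C + C') := by
  obtain ⟨ι, _, α, a, h1, h2⟩ := h
  obtain ⟨κ, _, β, c, h3, h4⟩ := h'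
  refine ⟨ι ⊕ κ, inferInstance, Sum.elim α β, Sum.elim a c, ?_, ?_⟩
  · simp only [Fintype.sum_sum_type, Sum.elim_inl, Sum.elim_inr]; linarith
  · intro v
    simp only [Fintype.sum_sum_type, Sum.elim_inl, Sum.elim_inr, h2, h4]

lemma PolyRep.mul {k : ℕ} {p q : (Fin k → ℝ) → ℝ} {C C' : ℝ} (h : PolyRep p C) (h' : PolyRep q C') :
    PolyRep (fun v => p v * q v) (C * C') := by
  obtain ⟨ι, _, α, a, h1, h2⟩ := h
  obtain ⟨κ, _, β, c, h3, h4⟩ := h'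
  refine ⟨ι × κ, inferInstance, fun i => α i.1 + β i.2, fun i => a i.1 * c i.2, ?_, ?_⟩
  · simp only [abs_mul, ← Finset.univ_product_univ]
    rw [Finset.sum_product]
    simp only []
    rw [← Finset.sum_mul_sum]
    have : 0 ≤ ∑ i, |c i| := by positivity
    have : 0 ≤ ∑ i, |a i| := by positivity
    gcongr
    linarith
  · intro v
    simp only [h2, h4, ← Finset.univ_product_univ]
    rw [Finset.sum_mul_sum, Finset.sum_product]
    refine sum_congr rfl fun i _ => sum_congr rfl fun j _ => ?_
    rw [mono_add]; ring

lemma PolyRep.sum {k : ℕ} {ι : Type*} (s : Finset ι) {p : ι → (Fin k → ℝ) → ℝ} {C : ι → ℝ}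
    (h : ∀ i ∈ s, PolyRep (p i) (C i)) : PolyRep (fun v => ∑ i ∈ s, p i v) (∑ i ∈ s, C i) := by
  classical
  induction s using Finset.induction_on with
  | empty => simpa using PolyRep.const (k := k) 0
  | insert a s ha ih =>
    simp only [Finset.sum_insert ha]
    exact (h a (by simp)).add (ih fun i hi => h i (by simp [hi]))

lemma PolyRep.nonneg {k : ℕ} {p : (Fin k → ℝ) → ℝ} {C : ℝ} (h : PolyRep p C) : 0 ≤ C := by
  obtain ⟨ι, _, α, a, h1, h2⟩ := h
  have : 0 ≤ ∑ i, |a i| := by positivity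
  linarith

lemma PolyRep.abs_le {k : ℕ} {p : (Fin k → ℝ) → ℝ} {C : ℝ} (h : PolyRep p C) (v : Fin k → ℝ)
    (hv : ‖v‖ ≤ 1) : |p v| ≤ C := by
  obtain ⟨ι, _, α, a, h1, h2⟩ := h
  rw [h2]
  refine (Finset.abs_sum_le_sum_abs _ _).trans (le_trans ?_ h1)
  apply Finset.sum_le_sum
  intro i _
  rw [abs_mul]
  have := abs_mono_le v (α i) 1 hv
  rw [one_pow] at this
  exact mul_le_of_le_one_right (abs_nonneg _) this

lemma PolyRep.truncate {k : ℕ} {p : (Fin k → ℝ) → ℝ} {C : ℝ} (h : PolyRep p C) (b : ℕ) :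
    ∃ A : (Fin k →₀ ℕ) → ℝ, (∀ α, |A α| ≤ C) ∧ ∀ v : Fin k → ℝ, ‖v‖ ≤ 1 →
      |p v - ∑ α ∈ degSet k b, A α * mono v α| ≤ C * ‖v‖ ^ (b + 1) := by
  classical
  obtain ⟨ι, _, α, a, h1, h2⟩ := h
  refine ⟨fun β => ∑ i with α i = β, a i, ?_, ?_⟩
  · intro β
    refine (Finset.abs_sum_le_sum_abs _ _).trans (le_trans ?_ h1)
    exact Finset.sum_le_sum_of_subset_of_nonneg (Finset.filter_subset _ _)
      (fun _ _ _ => abs_nonneg _)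
  · intro v hv
    have e1 : ∑ β ∈ degSet k b, (∑ i with α i = β, a i) * mono v β
        = ∑ i with α i ∈ degSet k b, a i * mono v (α i) := by
      rw [← Finset.sum_fiberwise_of_maps_to (s := Finset.univ.filter fun i => α i ∈ degSet k b)
        (t := degSet k b) (g := α) (by simp)]
      refine sum_congr rfl fun β hβ => ?_
      rw [Finset.sum_mul]
      have : (Finset.univ.filter fun i => α i ∈ degSet k b).filter (fun i => α i = β)
          = Finset.univ.filter fun i => α i = β := by
        ext i; simp only [mem_filter, mem_univ, true_and]
        constructor
        · exact fun h => h.2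
        · intro h; exact ⟨h ▸ hβ, h⟩
      rw [this]
      refine sum_congr rfl fun i hi => ?_
      rw [(mem_filter.1 hi).2]
    rw [e1, h2, ← Finset.sum_filter_add_sum_filter_not univ (fun i => α i ∈ degSet k b),
      add_sub_cancel_left]
    refine (Finset.abs_sum_le_sum_abs _ _).trans ?_
    calc _ ≤ ∑ i with ¬ α i ∈ degSet k b, |a i| * ‖v‖ ^ (b+1) := by
          apply Finset.sum_le_sum
          intro i hi
          rw [abs_mul]
          gcongr
          refine (abs_mono_le v (α i) _ le_rfl).trans ?_
          apply pow_le_pow_of_le_one (norm_nonneg _) hv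
          have := (mem_filter.1 hi).2
          rw [mem_degSet] at this
          omega
      _ = (∑ i with ¬ α i ∈ degSet k b, |a i|) * ‖v‖ ^ (b+1) := by rw [Finset.sum_mul]
      _ ≤ _ := by
          gcongr
          exact le_trans (Finset.sum_le_sum_of_subset_of_nonneg (Finset.filter_subset _ _)
            (fun _ _ _ => abs_nonneg _)) h1

/-- `g` is approximated near `z₀` to order `b` by a polynomial. -/
def PolyApprox {k : ℕ} (b : ℕ) (g : (Fin k → ℝ) → ℝ) (z₀ : Fin k → ℝ) (C : ℝ) : Prop :=
  ∃ p, PolyRep p C ∧ ∀ z ∈ unitCube k, ‖z - z₀‖ ≤ 1 → |g z - p (z - z₀)| ≤ C * ‖z - z₀‖ ^ (b + 1)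

lemma PolyApprox.mul {k b : ℕ} {g h : (Fin k → ℝ) → ℝ} {z₀ : Fin k → ℝ} {C C' : ℝ}
    (H : PolyApprox b g z₀ C) (H' : PolyApprox b h z₀ C') :
    PolyApprox b (fun z => g z * h z) z₀ (3 * C * C') := by
  obtain ⟨p, hp, hp'⟩ := H
  obtain ⟨q, hq, hq'⟩ := H'
  have hC := hp.nonneg
  have hC' := hq.nonneg
  refine ⟨_, (hp.mul hq).mono' (by nlinarith [mul_nonneg hC hC']), ?_⟩
  intro z hz hz1
  have a1 := hp' z hz hz1
  have a2 := hq' z hz hz1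
  have a3 := hp.abs_le _ hz1
  have a4 := hq.abs_le _ hz1
  set w := ‖z - z₀‖ ^ (b+1)
  have hw0 : 0 ≤ w := by positivity
  have hw1 : w ≤ 1 := pow_le_one₀ (norm_nonneg _) hz1
  have e : g z * h z - p (z - z₀) * q (z - z₀)
    = (g z - p (z - z₀)) * (h z - q (z - z₀)) + p (z - z₀) * (h z - q (z - z₀))
      + (g z - p (z - z₀)) * q (z - z₀) := by ring
  rw [e]
  refine (abs_add_three _ _ _).trans ?_
  rw [abs_mul, abs_mul, abs_mul]
  have b1 : |g z - p (z - z₀)| * |h z - q (z - z₀)| ≤ (C * w) * (C' * 1) := by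
    gcongr
    refine a2.trans (by gcongr)
  have b2 : |p (z - z₀)| * |h z - q (z - z₀)| ≤ C * (C' * w) := by gcongr
  have b3 : |g z - p (z - z₀)| * |q (z - z₀)| ≤ (C * w) * C' := by gcongr
  nlinarith

lemma PolyApprox.monomial {k b n : ℕ} {φ : (Fin k → ℝ) → Fin n → ℝ} {z₀ : Fin k → ℝ} {C : ℝ}
    (H : ∀ t, PolyApprox b (fun z => φ z t) z₀ C) (m : Fin n →₀ ℕ) :
    PolyApprox b (fun z => mono (φ z) m) z₀ ((3 * C) ^ m.degree) := by
  induction m using finsupp_ind with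
  | h0 =>
    refine ⟨fun _ => 1, by simpa using PolyRep.const (k := k) 1, ?_⟩
    intro z _ _
    simp [mono_zero]
  | h1 m t ih =>
    have := ih.mul (H t)
    simp only [mono_add, mono_single, map_add, Finsupp.degree_single]
    convert this using 1
    ring

lemma taylor_one (h : ℕ → ℝ → ℝ) (b : ℕ) (M : ℝ)
    (hd : ∀ j ≤ b, ∀ s ∈ Set.Icc (0:ℝ) 1, HasDerivAt (h j) (h (j+1) s) s)
    (hM : ∀ s ∈ Set.Icc (0:ℝ) 1, |h (b+1) s| ≤ M) :
    ∀ p i, i + p = b → ∀ s ∈ Set.Icc (0:ℝ) 1,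
      |h i s - ∑ j ∈ range (p+1), h (i+j) 0 * (s ^ j / (j.factorial : ℝ))| ≤ M := by
  have hM0 : 0 ≤ M := (abs_nonneg _).trans (hM 0 (by simp))
  intro p
  induction p with
  | zero =>
    intro i hi s hs
    have hib : i = b := by omega
    subst hib
    have := norm_image_sub_le_of_norm_deriv_le_segment' (a := (0:ℝ)) (b := 1) (f := h i)
      (f' := h (i+1)) (C := M) (fun x hx => (hd i le_rfl x hx).hasDerivWithinAt)
      (fun x hx => hM x ⟨hx.1, hx.2.le⟩) s hs
    simp only [zero_add, range_one, sum_singleton, add_zero, pow_zero, Nat.factorial_zero,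
      Nat.cast_one, div_one, mul_one]
    rw [Real.norm_eq_abs] at this
    refine this.trans ?_
    have := hs.2
    nlinarith
  | succ p ih =>
    intro i hi s hs
    have hder : ∀ x ∈ Set.Icc (0:ℝ) 1, HasDerivAt
        (fun s => h i s - ∑ j ∈ range (p+1+1), h (i+j) 0 * (s ^ j / (j.factorial : ℝ)))
        (h (i+1) x - ∑ j ∈ range (p+1), h (i+1+j) 0 * (x ^ j / (j.factorial : ℝ))) x := by
      intro x hx
      apply (hd i (by omega) x hx).sub
      simp only [Finset.sum_range_succ' _ (p+1), pow_zero]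
      apply HasDerivAt.add_const
      apply HasDerivAt.fun_sum
      intro j _
      have e : i + (j + 1) = i + 1 + j := by ring
      rw [e]
      apply HasDerivAt.const_mul
      have := (hasDerivAt_pow (j+1) x).div_const ((j+1).factorial : ℝ)
      have e2 : x ^ j / (j.factorial : ℝ)
          = ((j + 1 : ℕ) : ℝ) * x ^ (j + 1 - 1) / ((j+1).factorial : ℝ) := by
        rw [Nat.factorial_succ, Nat.add_sub_cancel]
        push_cast
        have h1 : (j.factorial : ℝ) ≠ 0 := by positivity
        have h2 : (j : ℝ) + 1 ≠ 0 := by positivity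
        field_simp
      rw [e2]
      exact this
    have := norm_image_sub_le_of_norm_deriv_le_segment' (a := (0:ℝ)) (b := 1) (C := M)
      (fun x hx => (hder x hx).hasDerivWithinAt)
      (fun x hx => ih (i+1) (by omega) x ⟨hx.1, hx.2.le⟩) s hs
    rw [Real.norm_eq_abs] at this
    have e0 : h i 0 - ∑ j ∈ range (p+1+1), h (i+j) 0 * ((0:ℝ) ^ j / (j.factorial : ℝ)) = 0 := by
      rw [Finset.sum_range_succ']
      simp
    rw [e0, sub_zero] at this
    refine this.trans ?_
    have := hs.2
    nlinarith

noncomputable def dirSum {k : ℕ} (f : (Fin k → ℝ) → ℝ) (v : Fin k → ℝ) :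
    ℕ → List (Fin k) → (Fin k → ℝ) → ℝ
  | 0, L, w => mixedPartialWithin (unitCube k) L f w
  | j+1, L, w => ∑ i, v i * dirSum f v j (i :: L) w

lemma dirSum_succ {k : ℕ} (f : (Fin k → ℝ) → ℝ) (v : Fin k → ℝ) (j : ℕ) (L : List (Fin k))
    (w : Fin k → ℝ) : dirSum f v (j+1) L w = ∑ i, v i * dirSum f v j (i :: L) w := rfl

lemma dirSum_rep {k b : ℕ} {f : (Fin k → ℝ) → ℝ} {B : ℝ}
    (hf : ∀ L : List (Fin k), L.length ≤ b + 1 → ∀ z ∈ unitCube k,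
      |mixedPartialWithin (unitCube k) L f z| ≤ B) (z₀ : Fin k → ℝ) (hz : z₀ ∈ unitCube k)
    (j : ℕ) (L : List (Fin k)) (hL : L.length + j ≤ b + 1) :
    PolyRep (fun v => dirSum f v j L z₀) ((k:ℝ)^j * B) := by
  induction j generalizing L with
  | zero =>
    simp only [dirSum]
    refine (PolyRep.const _).mono' ?_
    simpa using hf L (by omega) z₀ hz
  | succ j ih =>
    simp only [dirSum]
    have := PolyRep.sum (k := k) univ (fun (i : Fin k) _ => (PolyRep.coord i).mul
      (ih (i :: L) (by simp; omega)))
    refine this.mono' (le_of_eq ?_)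
    simp [pow_succ]
    ring

lemma dirSum_bound {k b : ℕ} {f : (Fin k → ℝ) → ℝ} {B : ℝ}
    (hf : ∀ L : List (Fin k), L.length ≤ b + 1 → ∀ z ∈ unitCube k,
      |mixedPartialWithin (unitCube k) L f z| ≤ B) (z₀ v : Fin k → ℝ) (hz : z₀ ∈ unitCube k)
    (j : ℕ) (L : List (Fin k)) (hL : L.length + j ≤ b + 1) :
    |dirSum f v j L z₀| ≤ (k:ℝ)^j * B * ‖v‖ ^ j := by
  induction j generalizing L with
  | zero =>
    simpa [dirSum] using hf L (by omega) z₀ hz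
  | succ j ih =>
    simp only [dirSum]
    refine (Finset.abs_sum_le_sum_abs _ _).trans ?_
    calc _ ≤ ∑ i : Fin k, ‖v‖ * ((k:ℝ)^j * B * ‖v‖ ^ j) := by
          apply Finset.sum_le_sum
          intro i _
          rw [abs_mul]
          gcongr
          · exact norm_le_pi_norm v i
          · exact ih (i :: L) (by simp; omega)
      _ = _ := by simp [pow_succ]; ring

lemma isOpen_unitCube (k : ℕ) : IsOpen (unitCube k) :=
  isOpen_set_pi Set.finite_univ fun _ _ => isOpen_Ioo

lemma convex_unitCube (k : ℕ) : Convex ℝ (unitCube k) :=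
  convex_pi fun _ _ => convex_Ioo 0 1

lemma dirSum_deriv {k b : ℕ} {f : (Fin k → ℝ) → ℝ}
    (hf : ∀ L : List (Fin k), L.length < b + 1 →
      DifferentiableOn ℝ (mixedPartialWithin (unitCube k) L f) (unitCube k))
    (z₀ v : Fin k → ℝ) (s : ℝ) (hz : z₀ + s • v ∈ unitCube k)
    (j : ℕ) (L : List (Fin k)) (hL : L.length + j < b + 1) :
    HasDerivAt (fun s : ℝ => dirSum f v j L (z₀ + s • v)) (dirSum f v (j+1) L (z₀ + s • v)) s := by
  induction j generalizing L with
  | zero =>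
    simp only [dirSum]
    have h1 := (hf L (by omega) _ hz).hasFDerivWithinAt.hasFDerivAt
      ((isOpen_unitCube k).mem_nhds hz)
    have h2 : HasDerivAt (fun s : ℝ => z₀ + s • v) v s := by
      have := ((hasDerivAt_id s).smul_const v).const_add z₀
      simpa using this
    have h3 := h1.comp_hasDerivAt s h2
    have hval : ∑ i, v i * mixedPartialWithin (unitCube k) (i :: L) f (z₀ + s • v)
        = fderivWithin ℝ (mixedPartialWithin (unitCube k) L f) (unitCube k) (z₀ + s • v) v := by
      change ∑ i, v i * fderivWithin ℝ (mixedPartialWithin (unitCube k) L f) (unitCube k) (z₀ + s • v) (Pi.single i 1) = _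
      generalize fderivWithin ℝ (mixedPartialWithin (unitCube k) L f) (unitCube k)
        (z₀ + s • v) = Λ
      conv_rhs => rw [pi_eq_sum_univ' v]
      rw [map_sum]
      refine sum_congr rfl fun i _ => ?_
      rw [map_smul, smul_eq_mul]
    rw [hval]
    exact h3
  | succ j ih =>
    simp only [dirSum_succ f v _ L]
    apply HasDerivAt.fun_sum
    intro i _
    exact (ih (i :: L) (by simp; omega)).const_mul _

lemma taylor_approx {k b : ℕ} {f : (Fin k → ℝ) → ℝ} {B : ℝ} (hk : 1 ≤ k) (hB : 0 ≤ B)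
    (hf : ∀ L : List (Fin k), L.length < b + 1 →
      DifferentiableOn ℝ (mixedPartialWithin (unitCube k) L f) (unitCube k))
    (hf' : ∀ L : List (Fin k), L.length ≤ b + 1 → ∀ z ∈ unitCube k,
      |mixedPartialWithin (unitCube k) L f z| ≤ B) (z₀ : Fin k → ℝ) (hz₀ : z₀ ∈ unitCube k) :
    PolyApprox b f z₀ ((b + 1) * ((k:ℝ)^(b+1) * B)) := by
  have hk' : (1:ℝ) ≤ k := by exact_mod_cast hk
  refine ⟨fun v => ∑ j ∈ range (b+1), dirSum f v j [] z₀ * (1 / (j.factorial : ℝ)), ?_, ?_⟩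
  · have := PolyRep.sum (k := k) (range (b+1)) (fun (j : ℕ) hj =>
      (dirSum_rep hf' z₀ hz₀ j [] (by simp at hj ⊢; omega)).mul
        (PolyRep.const (1 / (j.factorial : ℝ))))
    refine this.mono' ?_
    calc _ ≤ ∑ j ∈ range (b+1), ((k:ℝ)^(b+1) * B) := by
          apply Finset.sum_le_sum
          intro j hj
          have h1 : |1 / (j.factorial : ℝ)| ≤ 1 := by
            rw [abs_of_nonneg (by positivity)]
            apply div_le_one_of_le₀ _ (by positivity)
            exact_mod_cast Nat.factorial_pos j
          have h2 : (k:ℝ)^j ≤ (k:ℝ)^(b+1) :=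
            pow_le_pow_right₀ hk' (by simp at hj; omega)
          calc _ ≤ (k:ℝ)^j * B * 1 := by gcongr
            _ ≤ _ := by rw [mul_one]; gcongr
      _ = _ := by simp
  · intro z hz _
    set v := z - z₀ with hv
    have hseg : ∀ s ∈ Set.Icc (0:ℝ) 1, z₀ + s • v ∈ unitCube k := by
      intro s hs
      exact (convex_unitCube k).add_smul_sub_mem hz₀ hz hs
    have := taylor_one (fun j s => dirSum f v j [] (z₀ + s • v)) b ((k:ℝ)^(b+1) * B * ‖v‖ ^ (b+1))
      (fun j hj s hs => dirSum_deriv hf z₀ v s (hseg s hs) j [] (by simp; omega))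
      (fun s hs => dirSum_bound hf' _ v (hseg s hs) (b+1) [] (by simp)) b 0 (by simp) 1 (by simp)
    simp only [one_smul, zero_smul, add_zero, zero_add, one_pow] at this
    rw [hv, add_sub_cancel, ← hv] at this
    rw [dirSum.eq_1 f v [] z] at this
    refine le_trans this ?_
    apply mul_le_mul_of_nonneg_right _ (by positivity)
    have : 0 ≤ (k:ℝ)^(b+1) * B := by positivity
    have : (0:ℝ) ≤ b := by positivity
    nlinarith

lemma pigeon {ι κ : Type*} (S : Finset ι) (R : Finset κ) (A : ι → κ → ℝ) (C0 : ℕ)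
    (hA : ∀ i α, |A i α| ≤ C0) (X M : ℕ) (hX : 1 ≤ X) (hM : 1 ≤ M) (w : κ → ℕ)
    (hcard : (2 * S.card * C0 + 2) ^ R.card * M ^ (∑ α ∈ R, w α) < (X + 1) ^ S.card) :
    ∃ y : ι → ℤ, (∀ i, |(y i : ℝ)| ≤ X) ∧ (∃ i ∈ S, y i ≠ 0) ∧
      ∀ α ∈ R, |∑ i ∈ S, (y i : ℝ) * A i α| ≤ X / (M : ℝ) ^ w α := by
  classical
  have hX' : (0:ℝ) < X := by exact_mod_cast hX
  have hM' : (0:ℝ) < M := by exact_mod_cast hM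
  let dom : Finset (S → ℕ) := Fintype.piFinset (fun _ => range (X+1))
  let Nb : κ → ℕ := fun α => S.card * C0 * M ^ w α
  let cod : Finset (R → ℤ) := Fintype.piFinset
    (fun α => Finset.Ico (-(Nb α : ℤ)) ((Nb α : ℤ) + 1))
  let F : (S → ℕ) → (R → ℤ) := fun x α => ⌊(∑ i, (x i : ℝ) * A i α) * (M : ℝ) ^ w α / X⌋
  have hc : cod.card < dom.card := by
    have h1 : dom.card = (X+1)^S.card := by simp [dom]
    have h2 : cod.card ≤ (2 * S.card * C0 + 2) ^ R.card * M ^ (∑ α ∈ R, w α) := by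
      have : cod.card = ∏ α : R, (2 * Nb α + 1) := by
        simp only [cod, Fintype.card_piFinset, Int.card_Ico]
        refine Finset.prod_congr rfl fun α _ => ?_
        omega
      rw [this, Finset.prod_coe_sort R (fun α => 2 * Nb α + 1), ← Finset.prod_pow_eq_pow_sum,
        ← Finset.prod_const, ← Finset.prod_mul_distrib]
      apply Finset.prod_le_prod'
      intro α _
      have : 1 ≤ M ^ w α := Nat.one_le_pow _ _ hM
      simp only [Nb]
      nlinarith
    omega
  have hmaps : ∀ x ∈ dom, F x ∈ cod := by
    intro x hx
    simp only [dom, Fintype.mem_piFinset, mem_range] at hx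
    simp only [cod, Fintype.mem_piFinset, F]
    intro α
    have hb : |(∑ i, (x i : ℝ) * A i α) * (M : ℝ) ^ w α / X| ≤ Nb α := by
      rw [abs_div, abs_mul, abs_of_pos hX', abs_of_pos (a := (M:ℝ) ^ w α) (by positivity),
        div_le_iff₀ hX']
      have : |∑ i, (x i : ℝ) * A i α| ≤ S.card * (X * C0) := by
        refine (Finset.abs_sum_le_sum_abs _ _).trans ?_
        calc _ ≤ ∑ i : S, (X:ℝ) * C0 := by
              apply Finset.sum_le_sum
              intro i _
              rw [abs_mul, Nat.abs_cast]
              have : (x i : ℝ) ≤ X := by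
                have := hx i
                exact_mod_cast (by omega : x i ≤ X)
              gcongr
              exact hA _ _
          _ = _ := by simp
      calc _ ≤ (S.card * (X * C0)) * (M:ℝ) ^ w α := by gcongr
        _ = _ := by simp only [Nb]; push_cast; ring
    rw [abs_le] at hb
    rw [Finset.mem_Ico]
    constructor
    · rw [Int.le_floor]; push_cast; exact hb.1
    · rw [Int.floor_lt]; push_cast; linarith [hb.2]
  obtain ⟨x, hx, x', hx', hne, heq⟩ := Finset.exists_ne_map_eq_of_card_lt_of_maps_to hc hmaps
  simp only [dom, Fintype.mem_piFinset, mem_range] at hx hx'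
  refine ⟨fun i => if h : i ∈ S then (x ⟨i, h⟩ : ℤ) - x' ⟨i, h⟩ else 0, ?_, ?_, ?_⟩
  · intro i
    by_cases h : i ∈ S
    · have h1 := hx ⟨i, h⟩
      have h2 := hx' ⟨i, h⟩
      simp only [h, dif_pos]
      have : |(x ⟨i, h⟩ : ℤ) - x' ⟨i, h⟩| ≤ X := by rw [abs_le]; omega
      exact_mod_cast this
    · simp [h]
  · by_contra hcon
    push Not at hcon
    apply hne
    ext i
    have := hcon i i.2
    simp only [i.2, dif_pos] at this
    have h3 : (x i : ℤ) - x' i = 0 := this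
    omega
  · intro α hα
    have h1 := congrFun heq ⟨α, hα⟩
    have h2 := Int.abs_sub_lt_one_of_floor_eq_floor h1
    simp only at h2
    have h3 : ∑ i ∈ S, (((if h : i ∈ S then (x ⟨i, h⟩ : ℤ) - x' ⟨i, h⟩ else 0 : ℤ)) : ℝ) * A i α
        = ∑ i, (x i : ℝ) * A i α - ∑ i, (x' i : ℝ) * A i α := by
      rw [← Finset.sum_coe_sort S, ← Finset.sum_sub_distrib]
      refine Finset.sum_congr rfl fun i _ => ?_
      simp only [i.2, dif_pos]
      push_cast
      ring
    rw [h3]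
    rw [← sub_div, ← sub_mul, abs_div, abs_mul, abs_of_pos hX',
      abs_of_pos (a := (M:ℝ) ^ w α) (by positivity), div_lt_one hX'] at h2
    rw [le_div_iff₀ (by positivity)]
    exact h2.le

lemma mono_lip {n : ℕ} (x y : Fin n → ℝ) (r : ℝ) (hr : 1 ≤ r) (hx : ‖x‖ ≤ r) (hy : ‖y‖ ≤ r)
    (m : Fin n →₀ ℕ) :
    |mono x m - mono y m| ≤ m.degree * r ^ m.degree * ‖x - y‖ := by
  induction m using finsupp_ind with
  | h0 => simp [mono_zero]
  | h1 m t ih =>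
    simp only [mono_add, mono_single, map_add, Finsupp.degree_single]
    have e : mono x m * x t - mono y m * y t
      = (mono x m - mono y m) * x t + mono y m * (x t - y t) := by ring
    rw [e]
    refine (abs_add_le _ _).trans ?_
    rw [abs_mul, abs_mul]
    have h1 : |x t| ≤ r := (norm_le_pi_norm x t).trans hx
    have h2 : |x t - y t| ≤ ‖x - y‖ := norm_le_pi_norm (x - y) t
    have h3 := abs_mono_le y m r hy
    calc _ ≤ (m.degree * r ^ m.degree * ‖x - y‖) * r + r ^ m.degree * ‖x - y‖ := by gcongr
      _ ≤ (m.degree * r ^ m.degree * ‖x - y‖) * r + r ^ (m.degree + 1) * ‖x - y‖ := by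
        gcongr
        omega
      _ = _ := by push_cast; ring

lemma rat_lower {n d : ℕ} (y : (Fin n →₀ ℕ) → ℤ) (q : Fin n → ℚ) (T : ℝ)
    (hq : (vecHeight q : ℝ) ≤ T)
    (hne : ∑ m ∈ degSet n d, (y m : ℝ) * mono (fun t => (q t : ℝ)) m ≠ 0) :
    1 ≤ T ^ (n * d) * |∑ m ∈ degSet n d, (y m : ℝ) * mono (fun t => (q t : ℝ)) m| := by
  set P : ℝ := ∏ t, ((q t).den : ℝ) ^ d with hP
  have hPpos : 0 < P := Finset.prod_pos fun t _ => by
    have := (q t).den_pos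
    positivity
  have hPle : P ≤ T ^ (n * d) := by
    have : P ≤ ∏ t : Fin n, T ^ d := by
      apply Finset.prod_le_prod
      · intros; positivity
      · intro t _
        gcongr
        refine le_trans ?_ hq
        have h1 : (q t).den ≤ ratHeight (q t) := le_max_right _ _
        have h2 : ratHeight (q t) ≤ vecHeight q :=
          Finset.le_sup (f := fun j => ratHeight (q j)) (mem_univ t)
        exact_mod_cast h1.trans h2
    refine this.trans (le_of_eq ?_)
    simp [← pow_mul, mul_comm]
  have hint : ∃ z : ℤ, P * ∑ m ∈ degSet n d, (y m : ℝ) * mono (fun t => (q t : ℝ)) m = z := by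
    refine ⟨∑ m ∈ degSet n d, y m * ∏ t, ((q t).num ^ m t * ((q t).den : ℤ) ^ (d - m t)), ?_⟩
    push_cast
    rw [Finset.mul_sum]
    refine Finset.sum_congr rfl fun m hm => ?_
    rw [mem_degSet] at hm
    rw [mul_left_comm]
    congr 1
    rw [hP, mono, ← Finset.prod_mul_distrib]
    refine Finset.prod_congr rfl fun t _ => ?_
    have h1 : m t ≤ d := (Finsupp.le_degree t m).trans hm
    have h2 : ((q t).den : ℝ) ≠ 0 := by exact_mod_cast (q t).den_nz
    have h3 : ((q t : ℚ) : ℝ) = (q t).num / (q t).den := Rat.cast_def _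
    rw [h3, div_pow]
    obtain ⟨e, he⟩ := Nat.exists_eq_add_of_le h1
    rw [he, Nat.add_sub_cancel_left, pow_add]
    field_simp
  obtain ⟨z, hz⟩ := hint
  have hz0 : z ≠ 0 := by
    rintro rfl
    rw [Int.cast_zero] at hz
    exact (mul_ne_zero hPpos.ne' hne) hz
  have h1 : (1:ℝ) ≤ |(z:ℝ)| := by exact_mod_cast Int.one_le_abs hz0
  rw [← hz, abs_mul, abs_of_pos hPpos] at h1
  refine h1.trans ?_
  gcongr

lemma poly_of {n d : ℕ} (y : (Fin n →₀ ℕ) → ℤ) (hy : ∃ m ∈ degSet n d, y m ≠ 0) :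
    ∃ (f : MvPolynomial (Fin n) ℚ) (Y : ℝ), 1 ≤ Y ∧ (∀ m ∈ degSet n d, |(y m : ℝ)| ≤ Y) ∧
      (f ≠ 0 ∧ f.totalDegree ≤ d ∧ (∀ m, |f.coeff m| ≤ 1) ∧ ∃ m, |f.coeff m| = 1) ∧
      (∀ x : Fin n → ℝ, MvPolynomial.eval x (MvPolynomial.map (algebraMap ℚ ℝ) f)
        = (∑ m ∈ degSet n d, (y m : ℝ) * mono x m) / Y) ∧
      (∀ q : Fin n → ℚ, ((MvPolynomial.eval q f : ℚ) : ℝ)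
        = (∑ m ∈ degSet n d, (y m : ℝ) * mono (fun t => (q t : ℝ)) m) / Y) := by
  classical
  obtain ⟨m₀, hm₀, hmax⟩ := Finset.exists_max_image (degSet n d) (fun m => |y m|)
    ⟨_, hy.choose_spec.1⟩
  obtain ⟨m₁, hm₁, hne⟩ := hy
  have hpos : 1 ≤ |y m₀| := (Int.one_le_abs hne).trans (hmax m₁ hm₁)
  set Z : ℤ := |y m₀| with hZ
  have hZ0 : (0:ℚ) < Z := by exact_mod_cast (by omega : (0:ℤ) < Z)
  set f : MvPolynomial (Fin n) ℚ :=
    ∑ m ∈ degSet n d, MvPolynomial.monomial m ((y m : ℚ) / Z) with hf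
  have hcoeff : ∀ m, f.coeff m = if m ∈ degSet n d then (y m : ℚ) / Z else 0 := by
    intro m
    simp [hf, MvPolynomial.coeff_sum, MvPolynomial.coeff_monomial]
  have hone : |f.coeff m₀| = 1 := by
    rw [hcoeff, if_pos hm₀, abs_div, abs_of_pos hZ0, hZ, Int.cast_abs]
    apply div_self
    rw [← Int.cast_abs, ← hZ]; exact hZ0.ne'
  have heval : ∀ x : Fin n → ℝ, MvPolynomial.eval x (MvPolynomial.map (algebraMap ℚ ℝ) f)
        = (∑ m ∈ degSet n d, (y m : ℝ) * mono x m) / (Z : ℝ) := by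
    intro x
    rw [hf, map_sum, map_sum, Finset.sum_div]
    refine Finset.sum_congr rfl fun m _ => ?_
    rw [MvPolynomial.map_monomial, MvPolynomial.eval_monomial, Finsupp.prod_fintype _ _ (by simp),
      mono]
    simp
    ring
  refine ⟨f, (Z : ℝ), by exact_mod_cast hpos, ?_, ⟨?_, ?_, ?_, m₀, hone⟩, heval, ?_⟩
  · intro m hm; exact_mod_cast hmax m hm
  · intro h0
    rw [h0] at hone
    simp at hone
  · rw [MvPolynomial.totalDegree]
    apply Finset.sup_le
    intro m hm
    rw [MvPolynomial.mem_support_iff, hcoeff] at hm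
    have hmS : m ∈ degSet n d := by
      by_contra h
      exact hm (if_neg h)
    rw [mem_degSet] at hmS
    exact hmS
  · intro m
    rw [hcoeff]
    split_ifs with h
    · rw [abs_div, abs_of_pos hZ0, div_le_one hZ0]
      exact_mod_cast hmax m h
    · simp
  · intro q
    rw [← heval]
    exact MvPolynomial.map_eval (algebraMap ℚ ℝ) q f

lemma covering {k M : ℕ} (hM : 1 ≤ M) :
    ∃ ctr : (Fin k → Fin M) → (Fin k → ℝ), (∀ a, ctr a ∈ unitCube k) ∧
      ∀ z ∈ unitCube k, ∃ a, ‖z - ctr a‖ ≤ 1 / (M : ℝ) := by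
  have hM' : (0:ℝ) < M := by exact_mod_cast hM
  refine ⟨fun a t => ((a t : ℕ) + 1/2 : ℝ) / M, ?_, ?_⟩
  · intro a t _
    have h1 : (((a t : ℕ) : ℝ)) + 1 ≤ M := by exact_mod_cast (a t).2
    constructor
    · positivity
    · rw [div_lt_one hM']; linarith
  · intro z hz
    have hz' : ∀ t, 0 < z t ∧ z t < 1 := fun t => hz t (Set.mem_univ t)
    have hlt : ∀ t, ⌊(M:ℝ) * z t⌋₊ < M := by
      intro t
      rw [Nat.floor_lt (by have := (hz' t).1; positivity)]
      have := (hz' t).2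
      nlinarith
    refine ⟨fun t => ⟨⌊(M:ℝ) * z t⌋₊, hlt t⟩, ?_⟩
    rw [pi_norm_le_iff_of_nonneg (by positivity)]
    intro t
    have h1 := Nat.floor_le (a := (M:ℝ) * z t) (by have := (hz' t).1; positivity)
    have h2 := Nat.lt_floor_add_one ((M:ℝ) * z t)
    have e : (z - fun t => ((⌊(M:ℝ) * z t⌋₊ : ℝ) + 1/2) / M) t
        = (M * z t - ⌊(M:ℝ) * z t⌋₊ - 1/2) / M := by
      simp only [Pi.sub_apply]
      field_simp
      ring
    simp only at e ⊢
    rw [e, Real.norm_eq_abs, abs_div, abs_of_pos hM']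
    gcongr
    rw [abs_le]
    constructor <;> linarith

lemma params (b d k n : ℕ) (hb : 1 ≤ b) (hk : 1 ≤ k) (E W D K : ℕ) (hE : 1 ≤ E)
    (hED : E ≤ D) (hW : (k + 1) * W = (k + b + 1) * E) (hK : 1 ≤ K) (C3 : ℝ) (hC3 : 1 ≤ C3) :
    ∃ σ : ℝ, 1 ≤ σ ∧ ∀ T : ℝ, 1 ≤ T → ∃ (M X : ℕ) (s : ℝ), 1 ≤ M ∧ 1 ≤ X ∧ 1 ≤ s ∧ s ≤ M ∧
      (M : ℝ) ^ k ≤ (2 * σ) ^ k * T ^ ((((k : ℝ) + 1) * (n : ℝ) * (d : ℝ)) / (b : ℝ)) ∧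
      K ^ E * M ^ W < (X + 1) ^ D ∧ 2 * C3 * X * T ^ (n * d) ≤ s ^ (b + 1) ∧
      (σ ^ (b + 1))⁻¹ * T ^ (-((((k : ℝ) + 1) * (n : ℝ) / (k : ℝ)) *
                  ((d : ℝ) * ((b : ℝ) + 1) / (b : ℝ)))) = (s ^ (b + 1))⁻¹ := by
  have hK' : (1:ℝ) ≤ K := by exact_mod_cast hK
  have hbR : (1:ℝ) ≤ b := by exact_mod_cast hb
  have hkR : (1:ℝ) ≤ k := by exact_mod_cast hk
  have hWlt : W + 1 ≤ (b + 1) * E := by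
    have h1 : 1 ≤ k * b * E := by
      have : 0 < k * b * E := by positivity
      exact this
    have h2 : (k+1) * W + k * b * E = (k+1) * ((b+1) * E) := by rw [hW]; ring
    by_contra hcon
    have h3 : (b+1) * E ≤ W := by omega
    have := Nat.mul_le_mul_left (k+1) h3
    omega
  set σ : ℝ := (2 * C3 * K) ^ E * 2 ^ W with hσ
  have hbase : 1 ≤ 2 * C3 * K := by nlinarith
  have hσ1 : 1 ≤ σ := one_le_mul_of_one_le_of_one_le (one_le_pow₀ hbase)
    (one_le_pow₀ (by norm_num))
  refine ⟨σ, hσ1, fun T hT => ?_⟩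
  have hT0 : 0 < T := by linarith
  set e : ℝ := ((k:ℝ) + 1) * n * d / (k * b) with he
  have he0 : 0 ≤ e := by positivity
  set τ : ℝ := T ^ e with hτ
  have hτ1 : 1 ≤ τ := Real.one_le_rpow hT he0
  set s := σ * τ with hs
  have hs1 : 1 ≤ s := one_le_mul_of_one_le_of_one_le hσ1 hτ1
  have hs0 : 0 < s := by linarith
  set M := ⌈s⌉₊ with hM
  have hsM : s ≤ M := Nat.le_ceil s
  have hM2 : (M:ℝ) ≤ 2 * s := by
    have := Nat.ceil_lt_add_one hs0.le
    linarith
  have hM1 : 1 ≤ M := by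
    have : (1:ℝ) ≤ M := hs1.trans hsM
    exact_mod_cast this
  set Y : ℝ := s ^ (b+1) / (2 * C3 * T ^ (n * d)) with hY
  have hY0 : 0 < Y := by positivity
  have hkey : T ^ (n * d * E) * τ ^ W = τ ^ ((b+1) * E) := by
    rw [hτ, ← Real.rpow_natCast, ← Real.rpow_natCast (T ^ e) W,
      ← Real.rpow_natCast (T ^ e) ((b+1)*E), ← Real.rpow_mul hT0.le, ← Real.rpow_mul hT0.le,
      ← Real.rpow_add hT0]
    congr 1
    have hWR : ((k:ℝ) + 1) * W = (k + b + 1) * E := by exact_mod_cast hW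
    rw [he]
    push_cast
    have hk0 : (k:ℝ) ≠ 0 := by positivity
    have hb0 : (b:ℝ) ≠ 0 := by positivity
    field_simp
    linear_combination (n:ℝ) * d * hWR
  have hYE : (K:ℝ) ^ E * (M:ℝ) ^ W ≤ Y ^ E := by
    have h1 : Y ^ E = σ ^ ((b+1)*E) * τ ^ W / (2 * C3) ^ E := by
      rw [hY, hs, div_pow, ← pow_mul, mul_pow, ← hkey, mul_pow, ← pow_mul]
      have : T ^ (n * d * E) ≠ 0 := by positivity
      field_simp
      rw [mul_pow (2 * C3), ← pow_mul]
      ring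
    rw [h1, le_div_iff₀ (by positivity)]
    calc (K:ℝ) ^ E * (M:ℝ) ^ W * (2 * C3) ^ E ≤ (K:ℝ) ^ E * (2 * s) ^ W * (2 * C3) ^ E := by
          gcongr
      _ = σ ^ (W + 1) * τ ^ W := by
          rw [hs, pow_succ]
          nth_rewrite 3 [hσ]
          rw [mul_pow, mul_pow, mul_pow (2 * C3)]
          ring
      _ ≤ _ := by gcongr
  have hYE1 : 1 ≤ Y ^ E := by
    refine le_trans ?_ hYE
    exact one_le_mul_of_one_le_of_one_le (one_le_pow₀ hK')
      (one_le_pow₀ (by exact_mod_cast hM1))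
  have hY1 : 1 ≤ Y := by
    by_contra hcon
    push Not at hcon
    have := pow_lt_one₀ hY0.le hcon (by omega : E ≠ 0)
    linarith
  refine ⟨M, ⌊Y⌋₊, s, hM1, ?_, hs1, hsM, ?_, ?_, ?_, ?_⟩
  · exact Nat.le_floor (by simpa using hY1)
  · calc (M:ℝ)^k ≤ (2 * s) ^ k := by gcongr
      _ = (2 * σ) ^ k * τ ^ k := by rw [hs]; ring
      _ = _ := by
        congr 1
        rw [hτ, ← Real.rpow_natCast, ← Real.rpow_mul hT0.le]
        congr 1
        rw [he]
        field_simp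
  · have h1 : Y < (⌊Y⌋₊ : ℝ) + 1 := Nat.lt_floor_add_one Y
    have h2 : (K:ℝ) ^ E * (M:ℝ) ^ W < ((⌊Y⌋₊ : ℝ) + 1) ^ D := by
      calc _ ≤ Y ^ E := hYE
        _ < ((⌊Y⌋₊ : ℝ) + 1) ^ E := pow_lt_pow_left₀ h1 hY0.le (by omega)
        _ ≤ _ := pow_le_pow_right₀ (by linarith) hED
    exact_mod_cast h2
  · have h1 := Nat.floor_le hY0.le
    rw [hY, le_div_iff₀ (by positivity)] at h1
    calc _ = (⌊s ^ (b+1) / (2 * C3 * T ^ (n * d))⌋₊ : ℝ) * (2 * C3 * T ^ (n * d)) := by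
          rw [← hY]; ring
      _ ≤ _ := h1
  · have e3 : T ^ (-((((k : ℝ) + 1) * (n : ℝ) / (k : ℝ)) *
                  ((d : ℝ) * ((b : ℝ) + 1) / (b : ℝ)))) = (τ ^ (b+1))⁻¹ := by
      rw [Real.rpow_neg hT0.le, hτ, ← Real.rpow_natCast (T ^ e), ← Real.rpow_mul hT0.le]
      congr 2
      rw [he]
      push_cast
      field_simp
    rw [e3, hs, mul_pow σ τ, mul_inv]

lemma cell {b d k n : ℕ} {φ : (Fin k → ℝ) → Fin n → ℝ} {z₀ : Fin k → ℝ} {C : ℝ} (hC : 1 ≤ 3 * C)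
    (H : ∀ t, PolyApprox b (fun z => φ z t) z₀ C) (C0 : ℕ) (hC0 : (3 * C) ^ d ≤ C0)
    (X M : ℕ) (hX : 1 ≤ X) (hM : 1 ≤ M)
    (hcard : (2 * (degSet n d).card * C0 + 2) ^ (degSet k b).card *
      M ^ (∑ α ∈ degSet k b, (b + 1 - α.degree)) < (X + 1) ^ (degSet n d).card) :
    ∃ y : (Fin n →₀ ℕ) → ℤ, (∀ m, |(y m : ℝ)| ≤ X) ∧ (∃ m ∈ degSet n d, y m ≠ 0) ∧
      ∀ z ∈ unitCube k, ‖z - z₀‖ ≤ 1 / (M:ℝ) →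
        |∑ m ∈ degSet n d, (y m : ℝ) * mono (φ z) m| ≤
          X * (2 * (degSet n d).card * C0 + (degSet k b).card) / (M:ℝ) ^ (b + 1) := by
  classical
  have hM' : (0:ℝ) < M := by exact_mod_cast hM
  have hA : ∀ m, ∃ A : (Fin k →₀ ℕ) → ℝ, (∀ α, |A α| ≤ C0) ∧ (m ∈ degSet n d →
      ∀ z ∈ unitCube k, ‖z - z₀‖ ≤ 1 →
      |mono (φ z) m - ∑ α ∈ degSet k b, A α * mono (z - z₀) α| ≤ 2 * C0 * ‖z - z₀‖ ^ (b+1)) := by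
    intro m
    by_cases hm : m ∈ degSet n d
    · obtain ⟨p, hp, hp'⟩ := PolyApprox.monomial H m
      have hle : (3 * C) ^ m.degree ≤ C0 :=
        (pow_le_pow_right₀ hC (mem_degSet.1 hm)).trans hC0
      obtain ⟨A, hA1, hA2⟩ := (hp.mono' hle).truncate b
      refine ⟨A, hA1, fun _ z hz hz1 => ?_⟩
      have h1 := hp' z hz hz1
      have h2 := hA2 (z - z₀) hz1
      have h3 : (3 * C) ^ m.degree * ‖z - z₀‖ ^ (b+1) ≤ C0 * ‖z - z₀‖ ^ (b+1) := by gcongr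
      have h4 := abs_sub_le (mono (φ z) m) (p (z - z₀))
        (∑ α ∈ degSet k b, A α * mono (z - z₀) α)
      linarith
    · exact ⟨fun _ => 0, by simp, fun h => absurd h hm⟩
  choose A hA1 hA2 using hA
  obtain ⟨y, hy1, hy2, hy3⟩ := pigeon (degSet n d) (degSet k b) A C0 hA1 X M hX hM
    (fun α => b + 1 - α.degree) hcard
  refine ⟨y, hy1, hy2, fun z hz hzM => ?_⟩
  have hM1 : 1 / (M:ℝ) ≤ 1 := by
    rw [div_le_one hM']; exact_mod_cast hM
  have hz1 := hzM.trans hM1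
  have e : ∑ m ∈ degSet n d, (y m : ℝ) * mono (φ z) m
      = ∑ m ∈ degSet n d, (y m : ℝ) *
          (mono (φ z) m - ∑ α ∈ degSet k b, A m α * mono (z - z₀) α)
        + ∑ α ∈ degSet k b, (∑ m ∈ degSet n d, (y m : ℝ) * A m α) * mono (z - z₀) α := by
    simp only [mul_sub, Finset.sum_sub_distrib, Finset.sum_mul, Finset.mul_sum]
    rw [Finset.sum_comm (s := degSet k b)]
    simp only [mul_assoc]
    ring
  rw [e]
  refine (abs_add_le _ _).trans ?_
  have b1 : |∑ m ∈ degSet n d, (y m : ℝ) *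
          (mono (φ z) m - ∑ α ∈ degSet k b, A m α * mono (z - z₀) α)|
      ≤ (degSet n d).card * (X * (2 * C0 * (1 / (M:ℝ)) ^ (b+1))) := by
    refine (Finset.abs_sum_le_sum_abs _ _).trans ?_
    rw [← nsmul_eq_mul, ← Finset.sum_const]
    apply Finset.sum_le_sum
    intro m hm
    rw [abs_mul]
    have := hA2 m hm z hz hz1
    have h3 : 2 * C0 * ‖z - z₀‖ ^ (b+1) ≤ 2 * C0 * (1 / (M:ℝ)) ^ (b+1) := by gcongr
    have h4 := hy1 m
    gcongr
    exact this.trans h3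
  have b2 : |∑ α ∈ degSet k b, (∑ m ∈ degSet n d, (y m : ℝ) * A m α) * mono (z - z₀) α|
      ≤ (degSet k b).card * (X * (1 / (M:ℝ)) ^ (b+1)) := by
    refine (Finset.abs_sum_le_sum_abs _ _).trans ?_
    rw [← nsmul_eq_mul, ← Finset.sum_const]
    apply Finset.sum_le_sum
    intro α hα
    rw [abs_mul]
    have h1 := hy3 α hα
    have h2 := abs_mono_le (z - z₀) α _ hzM
    calc _ ≤ (X / (M:ℝ) ^ (b + 1 - α.degree)) * (1 / (M:ℝ)) ^ α.degree := by gcongr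
      _ = _ := by
        have h3 : b + 1 = (b + 1 - α.degree) + α.degree := by
          have := mem_degSet.1 hα
          omega
        conv_rhs => rw [h3, pow_add]
        rw [one_div_pow, one_div_pow]
        ring
  refine (add_le_add b1 b2).trans (le_of_eq ?_)
  rw [one_div_pow]
  ring

lemma main (b d k n : ℕ)
    (hb : 1 ≤ b) (hd : 1 ≤ d) (hk : 1 ≤ k) (hn : 1 ≤ n)
    (hDD : 2 * (k + b).choose k ≤ (n + d).choose n) (B : ℝ) (hB : 1 ≤ B) :
    ∃ c : ℝ, 1 ≤ c ∧
      ∀ φ : (Fin k → ℝ) → Fin n → ℝ,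
        (∀ (t : Fin n) (L : List (Fin k)), L.length < b + 1 →
          DifferentiableOn ℝ (mixedPartialWithin (unitCube k) L fun z => φ z t)
            (unitCube k)) →
        (∀ (t : Fin n) (L : List (Fin k)), L.length ≤ b + 1 →
          ContinuousOn (mixedPartialWithin (unitCube k) L fun z => φ z t) (unitCube k)) →
        (∀ (t : Fin n) (L : List (Fin k)), L.length ≤ b + 1 →
          ∀ z ∈ unitCube k,
            |mixedPartialWithin (unitCube k) L (fun z => φ z t) z| ≤ B) →
        ∀ T : ℝ, 1 ≤ T →
          ∃ (N : ℕ) (f : Fin N → MvPolynomial (Fin n) ℚ), 1 ≤ N ∧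
            (N : ℝ) ≤ c * T ^ ((((k : ℝ) + 1) * (n : ℝ) * (d : ℝ)) / (b : ℝ)) ∧
            (∀ j, f j ≠ 0 ∧ (f j).totalDegree ≤ d ∧
              (∀ m, |(f j).coeff m| ≤ 1) ∧ ∃ m, |(f j).coeff m| = 1) ∧
            ∀ z ∈ unitCube k, ∀ q : Fin n → ℚ, (vecHeight q : ℝ) ≤ T →
              ‖φ z - (fun t => (q t : ℝ))‖ <
                c⁻¹ * T ^ (-((((k : ℝ) + 1) * (n : ℝ) / (k : ℝ)) *
                  ((d : ℝ) * ((b : ℝ) + 1) / (b : ℝ)))) →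
              ∃ j, MvPolynomial.eval q (f j) = 0 ∧
                |MvPolynomial.eval (φ z) (MvPolynomial.map (algebraMap ℚ ℝ) (f j))| ≤
                  c * ‖φ z - (fun t => (q t : ℝ))‖ := by
  have hED : (degSet k b).card ≤ (degSet n d).card := by
    rw [card_degSet, card_degSet]; omega
  have hE1 : 1 ≤ (degSet k b).card := by
    rw [card_degSet]; exact Nat.choose_pos (by omega)
  have hW : (k + 1) * (∑ α ∈ degSet k b, (b + 1 - α.degree)) = (k + b + 1) * (degSet k b).card := by
    rw [weight_degSet, card_degSet, weight_mul]
  have hkR : (1:ℝ) ≤ k := by exact_mod_cast hk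
  set CT : ℝ := (b + 1) * ((k:ℝ)^(b+1) * B) with hCT
  have hCT1 : 1 ≤ CT := by
    have h1 : 1 ≤ (k:ℝ)^(b+1) * B := one_le_mul_of_one_le_of_one_le (one_le_pow₀ hkR) hB
    have h2 : (0:ℝ) ≤ b := by positivity
    rw [hCT]
    nlinarith
  set C0 : ℕ := ⌈(3 * CT) ^ d⌉₊ with hC0
  set C2 : ℝ := (degSet n d).card * (d * (B + 1) ^ d) with hC2
  have hC2nn : 0 ≤ C2 := by positivity
  set C1 : ℝ := 2 * (degSet n d).card * C0 + (degSet k b).card with hC1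
  have hC11 : 1 ≤ C1 := by
    have h1 : (1:ℝ) ≤ (degSet k b).card := by exact_mod_cast hE1
    have h2 : (0:ℝ) ≤ 2 * (degSet n d).card * C0 := by positivity
    linarith
  obtain ⟨σ, hσ1, hpar⟩ := params b d k n hb hk (degSet k b).card _ (degSet n d).card
    (2 * (degSet n d).card * C0 + 2) hE1 hED hW (by omega) (C1 + C2) (by linarith)
  have hc1 : σ ^ (b + 1) ≤ σ ^ (b + 1) + (2 * σ) ^ k + C2 := by
    have : 0 ≤ (2 * σ) ^ k := by positivity
    linarith
  have hσp : 0 < σ ^ (b + 1) := by positivity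
  have hσp' : 0 < (2 * σ) ^ k := by positivity
  refine ⟨σ ^ (b + 1) + (2 * σ) ^ k + C2, (one_le_pow₀ hσ1).trans hc1, ?_⟩
  intro φ hdiff _ hbd T hT
  obtain ⟨M, X, s, hM1, hX1, hs1, hsM, hMk, hcard, hXT, hsε⟩ := hpar T hT
  have hs0 : 0 < s := by linarith
  have hX0 : (0:ℝ) < X := by exact_mod_cast hX1
  have hM0 : (0:ℝ) < M := by exact_mod_cast hM1
  obtain ⟨ctr, hctr, hcov⟩ := covering (k := k) hM1
  have hcell : ∀ a, ∃ y : (Fin n →₀ ℕ) → ℤ, (∀ m, |(y m : ℝ)| ≤ X) ∧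
      (∃ m ∈ degSet n d, y m ≠ 0) ∧
      ∀ z ∈ unitCube k, ‖z - ctr a‖ ≤ 1 / (M:ℝ) →
        |∑ m ∈ degSet n d, (y m : ℝ) * mono (φ z) m| ≤ X * C1 / (M:ℝ) ^ (b + 1) := by
    intro a
    exact cell (C := CT) (by linarith)
      (fun t => taylor_approx hk (by linarith) (hdiff t) (hbd t) (ctr a) (hctr a))
      C0 (Nat.le_ceil _) X M hX1 hM1 hcard
  choose y hy1 hy2 hy3 using hcell
  choose f Y hY1 hYy hf hev hevq using fun a => poly_of (y a) (hy2 a)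
  let eqv := Fintype.equivFin (Fin k → Fin M)
  have hcardN : Fintype.card (Fin k → Fin M) = M ^ k := by simp
  refine ⟨Fintype.card (Fin k → Fin M), fun j => f (eqv.symm j), ?_, ?_, fun j => hf _, ?_⟩
  · rw [hcardN]; exact Nat.one_le_pow _ _ hM1
  · rw [hcardN]
    push_cast
    refine hMk.trans ?_
    have : 0 ≤ T ^ ((((k : ℝ) + 1) * (n : ℝ) * (d : ℝ)) / (b : ℝ)) := by positivity
    gcongr
    linarith
  · intro z hz q hq hlt
    obtain ⟨a, ha⟩ := hcov z hz
    refine ⟨eqv a, ?_⟩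
    simp only [Equiv.symm_apply_apply]
    set qr : Fin n → ℝ := fun t => (q t : ℝ) with hqr
    have hε : ‖φ z - qr‖ ≤ (s ^ (b + 1))⁻¹ := by
      refine hlt.le.trans ?_
      rw [← hsε]
      gcongr
    have hs1' : (s ^ (b + 1))⁻¹ ≤ 1 := inv_le_one_of_one_le₀ (one_le_pow₀ hs1)
    have hφB : ‖φ z‖ ≤ B := by
      rw [pi_norm_le_iff_of_nonneg (by linarith)]
      intro t
      exact hbd t [] (by simp) z hz
    have hqB : ‖qr‖ ≤ B + 1 := by
      have h1 : ‖qr‖ ≤ ‖φ z‖ + ‖φ z - qr‖ := by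
        have := norm_sub_le (φ z) (φ z - qr)
        rwa [sub_sub_cancel] at this
      linarith
    have hlip : ∀ m ∈ degSet n d, |mono (φ z) m - mono qr m| ≤
        d * (B + 1) ^ d * ‖φ z - qr‖ := by
      intro m hm
      rw [mem_degSet] at hm
      refine (mono_lip (φ z) qr (B+1) (by linarith) (by linarith) hqB m).trans ?_
      have h1 : (B + 1) ^ m.degree ≤ (B + 1) ^ d := pow_le_pow_right₀ (by linarith) hm
      have h2 : ((m.degree : ℕ) : ℝ) ≤ d := by exact_mod_cast hm
      gcongr
    have hdif : ∀ Q : ℝ, (∀ m ∈ degSet n d, |(y a m : ℝ)| ≤ Q) →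
        |∑ m ∈ degSet n d, (y a m : ℝ) * mono (φ z) m - ∑ m ∈ degSet n d, (y a m : ℝ) * mono qr m|
          ≤ Q * (C2 * ‖φ z - qr‖) := by
      intro Q hQ
      rw [← Finset.sum_sub_distrib]
      refine (Finset.abs_sum_le_sum_abs _ _).trans ?_
      calc _ ≤ ∑ m ∈ degSet n d, Q * (d * (B + 1) ^ d * ‖φ z - qr‖) := by
            apply Finset.sum_le_sum
            intro m hm
            rw [← mul_sub, abs_mul]
            have h1 := hQ m hm
            have h2 := hlip m hm
            have h3 : 0 ≤ Q := (abs_nonneg _).trans h1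
            gcongr
        _ = _ := by
            rw [Finset.sum_const, nsmul_eq_mul, hC2]
            ring
    have hzero : ∑ m ∈ degSet n d, (y a m : ℝ) * mono qr m = 0 := by
      by_contra hne
      have h1 := rat_lower (y a) q T hq hne
      have h2 := hy3 a z hz ha
      have h3 := hdif X (fun m _ => hy1 a m)
      have h4 : X * C1 / (M:ℝ) ^ (b + 1) ≤ X * C1 * (s ^ (b + 1))⁻¹ := by
        rw [div_eq_mul_inv]
        gcongr
      have h5 : X * (C2 * ‖φ z - qr‖) ≤ X * (C2 * (s ^ (b + 1))⁻¹) := by gcongr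
      have h6 : |∑ m ∈ degSet n d, (y a m : ℝ) * mono qr m| ≤ X * (C1 + C2) * (s ^ (b + 1))⁻¹ := by
        have := abs_sub_abs_le_abs_sub (∑ m ∈ degSet n d, (y a m : ℝ) * mono qr m)
          (∑ m ∈ degSet n d, (y a m : ℝ) * mono (φ z) m)
        rw [abs_sub_comm] at this
        linarith
      have hT0 : 0 ≤ T ^ (n * d) := by positivity
      have h7 : T ^ (n * d) * (X * (C1 + C2) * (s ^ (b + 1))⁻¹) ≤ 1 / 2 := by
        rw [← mul_assoc, ← div_eq_mul_inv, div_le_iff₀ (by positivity)]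
        linarith
      have h8 := mul_le_mul_of_nonneg_left h6 hT0
      linarith
    constructor
    · have h1 := hevq a q
      rw [hzero, zero_div] at h1
      exact_mod_cast h1
    · rw [hev a]
      have h1 := hdif (Y a) (hYy a)
      rw [hzero, sub_zero] at h1
      have hYp : 0 < Y a := by linarith [hY1 a]
      rw [abs_div, abs_of_pos hYp, div_le_iff₀ hYp]
      refine h1.trans ?_
      rw [mul_comm]
      gcongr
      linarith

end AuxPoly

/-- Construction of the auxiliary polynomials (Proposition on the auxiliary function,
rational case): given `b, d, k, n ≥ 1` with `C(n+d,n) ≥ 2·C(k+b,k)` and `B ≥ 1`,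
there is `c ≥ 1` such that for every map `φ : (0,1)ᵏ → ℝⁿ` whose coordinate functions
have continuous partial derivatives up to order `b+1` bounded in modulus by `B`, and
every `T ≥ 1`, there are `N ≤ c·T^{(k+1)nd/b}` nonzero polynomials
`f₁, …, f_N ∈ ℚ[X₁,…,Xₙ]` of degree `≤ d` and coefficient max-norm `1` such that
whenever `z ∈ (0,1)ᵏ` and `q ∈ ℚⁿ` satisfy `H(q) ≤ T` and
`|φ(z) − q| < c⁻¹·T^{−((k+1)n/k)·(d(b+1)/b)}`, some `f_j` vanishes at `q` and
satisfies `|f_j(φ(z))| ≤ c·|φ(z) − q|`. -/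
theorem auxiliary_polynomial_construction (b d k n : ℕ)
    (hb : 1 ≤ b) (hd : 1 ≤ d) (hk : 1 ≤ k) (hn : 1 ≤ n)
    (hDD : 2 * (k + b).choose k ≤ (n + d).choose n) (B : ℝ) (hB : 1 ≤ B) :
    ∃ c : ℝ, 1 ≤ c ∧
      ∀ φ : (Fin k → ℝ) → Fin n → ℝ,
        (∀ (t : Fin n) (L : List (Fin k)), L.length < b + 1 →
          DifferentiableOn ℝ (mixedPartialWithin (unitCube k) L fun z => φ z t)
            (unitCube k)) →
        (∀ (t : Fin n) (L : List (Fin k)), L.length ≤ b + 1 →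
          ContinuousOn (mixedPartialWithin (unitCube k) L fun z => φ z t) (unitCube k)) →
        (∀ (t : Fin n) (L : List (Fin k)), L.length ≤ b + 1 →
          ∀ z ∈ unitCube k,
            |mixedPartialWithin (unitCube k) L (fun z => φ z t) z| ≤ B) →
        ∀ T : ℝ, 1 ≤ T →
          ∃ (N : ℕ) (f : Fin N → MvPolynomial (Fin n) ℚ), 1 ≤ N ∧
            (N : ℝ) ≤ c * T ^ ((((k : ℝ) + 1) * (n : ℝ) * (d : ℝ)) / (b : ℝ)) ∧
            (∀ j, f j ≠ 0 ∧ (f j).totalDegree ≤ d ∧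
              (∀ m, |(f j).coeff m| ≤ 1) ∧ ∃ m, |(f j).coeff m| = 1) ∧
            ∀ z ∈ unitCube k, ∀ q : Fin n → ℚ, (vecHeight q : ℝ) ≤ T →
              ‖φ z - (fun t => (q t : ℝ))‖ <
                c⁻¹ * T ^ (-((((k : ℝ) + 1) * (n : ℝ) / (k : ℝ)) *
                  ((d : ℝ) * ((b : ℝ) + 1) / (b : ℝ)))) →
              ∃ j, MvPolynomial.eval q (f j) = 0 ∧
                |MvPolynomial.eval (φ z) (MvPolynomial.map (algebraMap ℚ ℝ) (f j))| ≤
                  c * ‖φ z - (fun t => (q t : ℝ))‖ := by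
  exact AuxPoly.main b d k n hb hd hk hn hDD B hB
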